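/- arXiv:1712.09499 — 2 statements merged into one kernel-verified Lean document; each statement's English description precedes it below -/
import Mathlib

section
/- Let A ⊆ C, B ⊆ D and K ⊆ L be inclusions of C*-algebras with AC dense in C, BD dense in D and KL dense in L. Suppose A ⊆ C and B ⊆ D are strongly Morita equivalent with respect to a C–D-equivalence bimodule Y and its closed subspace X, and B ⊆ D and K ⊆ L are strongly Morita equivalent with respect to a D–L-equivalence bimodule W and its closed subspace Z. Let X⊗_D Z denote the closure of the linear span of {x⊗z ∈ Y⊗_D W | x ∈ X, z ∈ Z}, regarded as an A–K-equivalence bimodule. Then X⊗_D Z is isomorphic to the interior tensor product X⊗_B Z as A–K-equivalence bimodules. -/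
open scoped MultiplierAlgebra

noncomputable section

structure EquivBimodule (C D Y : Type*)
    [NonUnitalCStarAlgebra C] [PartialOrder C] [StarOrderedRing C]
    [NonUnitalCStarAlgebra D] [PartialOrder D] [StarOrderedRing D]
    [NormedAddCommGroup Y] [NormedSpace ℂ Y] [CompleteSpace Y] : Type _ where
  lsmul : C → Y → Y
  rsmul : Y → D → Y
  linn : Y → Y → C
  rinn : Y → Y → D
  lsmul_add : ∀ c x y, lsmul c (x + y) = lsmul c x + lsmul c y
  add_lsmul : ∀ c c' x, lsmul (c + c') x = lsmul c x + lsmul c' x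
  mul_lsmul : ∀ c c' x, lsmul (c * c') x = lsmul c (lsmul c' x)
  smul_lsmul : ∀ (z : ℂ) c x, lsmul (z • c) x = z • lsmul c x
  lsmul_smul : ∀ (z : ℂ) c x, lsmul c (z • x) = z • lsmul c x
  add_rsmul : ∀ x y d, rsmul (x + y) d = rsmul x d + rsmul y d
  rsmul_add : ∀ x d d', rsmul x (d + d') = rsmul x d + rsmul x d'
  rsmul_mul : ∀ x d d', rsmul x (d * d') = rsmul (rsmul x d) d'
  rsmul_smul : ∀ (z : ℂ) x d, rsmul (z • x) d = z • rsmul x d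
  smul_rsmul : ∀ (z : ℂ) x d, rsmul x (z • d) = z • rsmul x d
  lsmul_rsmul : ∀ c x d, rsmul (lsmul c x) d = lsmul c (rsmul x d)
  linn_add_left : ∀ x y z, linn (x + y) z = linn x z + linn y z
  linn_smul_left : ∀ (t : ℂ) x y, linn (t • x) y = t • linn x y
  linn_star : ∀ x y, star (linn x y) = linn y x
  linn_lsmul_left : ∀ c x y, linn (lsmul c x) y = c * linn x y
  linn_nonneg : ∀ x, 0 ≤ linn x x
  linn_definite : ∀ x, linn x x = 0 → x = 0
  rinn_add_right : ∀ x y z, rinn x (y + z) = rinn x y + rinn x z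
  rinn_smul_right : ∀ (t : ℂ) x y, rinn x (t • y) = t • rinn x y
  rinn_star : ∀ x y, star (rinn x y) = rinn y x
  rinn_rsmul_right : ∀ x y d, rinn x (rsmul y d) = rinn x y * d
  rinn_nonneg : ∀ x, 0 ≤ rinn x x
  rinn_definite : ∀ x, rinn x x = 0 → x = 0
  imprimitivity : ∀ x y z, lsmul (linn x y) z = rsmul x (rinn y z)
  norm_linn : ∀ x, ‖linn x x‖ = ‖x‖ ^ 2
  norm_rinn : ∀ x, ‖rinn x x‖ = ‖x‖ ^ 2
  full_left : Dense (Submodule.span ℂ {c : C | ∃ x y, c = linn x y} : Set C)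
  full_right : Dense (Submodule.span ℂ {d : D | ∃ x y, d = rinn x y} : Set D)

namespace EquivBimodule

variable {C D Y W : Type*}
    [NonUnitalCStarAlgebra C] [PartialOrder C] [StarOrderedRing C]
    [NonUnitalCStarAlgebra D] [PartialOrder D] [StarOrderedRing D]
    [NormedAddCommGroup Y] [NormedSpace ℂ Y] [CompleteSpace Y]
    [NormedAddCommGroup W] [NormedSpace ℂ W] [CompleteSpace W]

structure Iso (E : EquivBimodule C D Y) (F : EquivBimodule C D W) where
  toEquiv : Y ≃ₗ[ℂ] W
  map_lsmul : ∀ c y, toEquiv (E.lsmul c y) = F.lsmul c (toEquiv y)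
  map_rsmul : ∀ y d, toEquiv (E.rsmul y d) = F.rsmul (toEquiv y) d
  map_linn : ∀ x y, F.linn (toEquiv x) (toEquiv y) = E.linn x y
  map_rinn : ∀ x y, F.rinn (toEquiv x) (toEquiv y) = E.rinn x y

end EquivBimodule

def DenseIncl {A C : Type*} [NonUnitalCStarAlgebra C] (ι : A → C) : Prop :=
  Dense (Submodule.span ℂ {x : C | ∃ (a : A) (c : C), x = ι a * c} : Set C)

structure IsMoritaIncl {A B C D Y : Type*}
    [NonUnitalCStarAlgebra C] [PartialOrder C] [StarOrderedRing C]
    [NonUnitalCStarAlgebra D] [PartialOrder D] [StarOrderedRing D]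
    [NormedAddCommGroup Y] [NormedSpace ℂ Y] [CompleteSpace Y]
    (ιA : A → C) (ιB : B → D)
    (E : EquivBimodule C D Y) (X : Submodule ℂ Y) : Prop where
  closed : IsClosed (X : Set Y)
  lsmul_mem : ∀ (a : A), ∀ x ∈ X, E.lsmul (ιA a) x ∈ X
  rsmul_mem : ∀ (b : B), ∀ x ∈ X, E.rsmul x (ιB b) ∈ X
  linn_mem : ∀ x ∈ X, ∀ y ∈ X, E.linn x y ∈ Set.range ιA
  rinn_mem : ∀ x ∈ X, ∀ y ∈ X, E.rinn x y ∈ Set.range ιB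
  span_XX_left :
    closure (Submodule.span ℂ {c : C | ∃ x ∈ X, ∃ y ∈ X, c = E.linn x y} : Set C) = Set.range ιA
  span_YX_left :
    Dense (Submodule.span ℂ {c : C | ∃ (y : Y), ∃ x ∈ X, c = E.linn y x} : Set C)
  span_XX_right :
    closure (Submodule.span ℂ {d : D | ∃ x ∈ X, ∃ y ∈ X, d = E.rinn x y} : Set D) = Set.range ιB
  span_YX_right :
    Dense (Submodule.span ℂ {d : D | ∃ (y : Y), ∃ x ∈ X, d = E.rinn y x} : Set D)

abbrev IsEquiPair {A C Y : Type*}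
    [NonUnitalCStarAlgebra C] [PartialOrder C] [StarOrderedRing C]
    [NormedAddCommGroup Y] [NormedSpace ℂ Y] [CompleteSpace Y]
    (ι : A → C) (E : EquivBimodule C C Y) (X : Submodule ℂ Y) : Prop :=
  IsMoritaIncl ι ι E X

def PairEquiv {C D Y W : Type*}
    [NonUnitalCStarAlgebra C] [PartialOrder C] [StarOrderedRing C]
    [NonUnitalCStarAlgebra D] [PartialOrder D] [StarOrderedRing D]
    [NormedAddCommGroup Y] [NormedSpace ℂ Y] [CompleteSpace Y]
    [NormedAddCommGroup W] [NormedSpace ℂ W] [CompleteSpace W]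
    (E : EquivBimodule C D Y) (X : Submodule ℂ Y)
    (F : EquivBimodule C D W) (Z : Submodule ℂ W) : Prop :=
  ∃ Φ : E.Iso F, X.map Φ.toEquiv.toLinearMap = Z

def IsTrivialData {C : Type*}
    [NonUnitalCStarAlgebra C] [PartialOrder C] [StarOrderedRing C]
    (T : EquivBimodule C C C) : Prop :=
  T.lsmul = (fun c x => c * x) ∧ T.rsmul = (fun x c => x * c) ∧
    T.linn = (fun x y => x * star y) ∧ T.rinn = (fun x y => star x * y)

/-- The data of the equivalence bimodule `Y_σ` induced by an automorphism with
underlying map `σ` (with inverse `σinv`). -/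
def IsAlphaData {C : Type*}
    [NonUnitalCStarAlgebra C] [PartialOrder C] [StarOrderedRing C]
    (σ σinv : C → C) (T : EquivBimodule C C C) : Prop :=
  T.lsmul = (fun c x => c * x) ∧ T.rsmul = (fun x c => x * σ c) ∧
    T.linn = (fun x y => x * star y) ∧ T.rinn = (fun x y => σinv (star x * y))

/-- The submodule `{ι a | a : A}` of `C`, e.g. the subspace `X_α = A` of `Y_α = C`. -/
def rangeSub {A C : Type*} [NonUnitalCStarAlgebra C]
    (ι : A → C) : Submodule ℂ C :=
  Submodule.span ℂ (Set.range ι)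

/-- A realization of the interior tensor product `Y ⊗_D W` of equivalence bimodules. -/
structure IsTensorProd {C D L Y W V : Type*}
    [NonUnitalCStarAlgebra C] [PartialOrder C] [StarOrderedRing C]
    [NonUnitalCStarAlgebra D] [PartialOrder D] [StarOrderedRing D]
    [NonUnitalCStarAlgebra L] [PartialOrder L] [StarOrderedRing L]
    [NormedAddCommGroup Y] [NormedSpace ℂ Y] [CompleteSpace Y]
    [NormedAddCommGroup W] [NormedSpace ℂ W] [CompleteSpace W]
    [NormedAddCommGroup V] [NormedSpace ℂ V] [CompleteSpace V]
    (E : EquivBimodule C D Y) (G : EquivBimodule D L W)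
    (F : EquivBimodule C L V) (s : Y → W → V) : Prop where
  add_left : ∀ y y' w, s (y + y') w = s y w + s y' w
  smul_left : ∀ (z : ℂ) y w, s (z • y) w = z • s y w
  add_right : ∀ y w w', s y (w + w') = s y w + s y w'
  smul_right : ∀ (z : ℂ) y w, s y (z • w) = z • s y w
  balanced : ∀ y d w, s (E.rsmul y d) w = s y (G.lsmul d w)
  map_lsmul : ∀ c y w, F.lsmul c (s y w) = s (E.lsmul c y) w
  map_rsmul : ∀ y w l, F.rsmul (s y w) l = s y (G.rsmul w l)
  map_linn : ∀ y y' w w',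
    F.linn (s y w) (s y' w') = E.linn (E.rsmul y (G.linn w w')) y'
  map_rinn : ∀ y y' w w',
    F.rinn (s y w) (s y' w') = G.rinn w (G.lsmul (E.rinn y y') w')
  dense : Dense (Submodule.span ℂ {v : V | ∃ y w, v = s y w} : Set V)

/-- A realization of the product of two elements of `Equi(A, C)`:
the tensor product bimodule together with the distinguished subspace `X₁ ⊗ X₂`. -/
structure IsPairTensor {A C Y W V : Type*}
    [NonUnitalCStarAlgebra C] [PartialOrder C] [StarOrderedRing C]
    [NormedAddCommGroup Y] [NormedSpace ℂ Y] [CompleteSpace Y]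
    [NormedAddCommGroup W] [NormedSpace ℂ W] [CompleteSpace W]
    [NormedAddCommGroup V] [NormedSpace ℂ V] [CompleteSpace V]
    (ι : A → C)
    (E₁ : EquivBimodule C C Y) (X₁ : Submodule ℂ Y)
    (E₂ : EquivBimodule C C W) (X₂ : Submodule ℂ W)
    (G : EquivBimodule C C V) (XV : Submodule ℂ V) (s : Y → W → V) : Prop where
  tensor : IsTensorProd E₁ E₂ G s
  sub : (XV : Set V) =
    closure (Submodule.span ℂ {v : V | ∃ x ∈ X₁, ∃ z ∈ X₂, v = s x z} : Set V)

section Multiplier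

variable {C : Type*} [NonUnitalCStarAlgebra C]

/-- Conjugation `c ↦ u c u*` by a (unitary) multiplier `u ∈ M(C)`. -/
def mAd (u : 𝓜(ℂ, C)) (c : C) : C := u.fst ((star u).snd c)

/-- `m ∈ M(C)` is (the extension of) a multiplier of the subalgebra `A` (realized by
`ι : A → C`): it maps `A` into `A` on both sides.  When `AC` is dense in `C`, the
multiplier algebra `M(A)` is exactly the set of such multipliers. -/
def IsMultiplierOf {A : Type*} (ι : A → C) (m : 𝓜(ℂ, C)) : Prop :=
  (∀ a : A, m.fst (ι a) ∈ Set.range ι) ∧ (∀ a : A, m.snd (ι a) ∈ Set.range ι)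

/-- `u ∈ K(M(C))`: a unitary multiplier with `u a u*, u* a u ∈ A` for all `a ∈ A`. -/
def mem_KMC {A : Type*} (ι : A → C) (u : 𝓜(ℂ, C)) : Prop :=
  u ∈ unitary 𝓜(ℂ, C) ∧ (∀ a : A, mAd u (ι a) ∈ Set.range ι) ∧
    (∀ a : A, mAd (star u) (ι a) ∈ Set.range ι)

/-- The subspace `Au = {a u | a ∈ A}` of `C`, for a multiplier `u ∈ M(C)`. -/
def AuSub {A : Type*} (ι : A → C) (u : 𝓜(ℂ, C)) : Submodule ℂ C :=
  Submodule.span ℂ {x : C | ∃ a : A, x = u.snd (ι a)}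

end Multiplier

/-- A positive element `h` with `hA` dense in `A`; a C*-algebra is σ-unital iff it
possesses such a (strictly positive) element. -/
def SigmaUnital (A : Type*) [NonUnitalCStarAlgebra A] [PartialOrder A]
    [StarOrderedRing A] : Prop :=
  ∃ h : A, 0 ≤ h ∧ Dense (Set.range fun a : A => h * a)

/-- A system of matrix units over `C` realizing `Cs` as the stabilization `C ⊗ K`. -/
structure IsStabilization {C Cs : Type*} [NonUnitalCStarAlgebra C]
    [NonUnitalCStarAlgebra Cs] (e : ℕ → ℕ → C → Cs) : Prop where
  map_add : ∀ i j c c', e i j (c + c') = e i j c + e i j c'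
  map_smul : ∀ i j (z : ℂ) c, e i j (z • c) = z • e i j c
  map_mul : ∀ i j k l c d, e i j c * e k l d = if j = k then e i l (c * d) else 0
  map_star : ∀ i j c, star (e i j c) = e j i (star c)
  isometry : ∀ i j c, ‖e i j c‖ = ‖c‖
  dense : Dense (Submodule.span ℂ {x : Cs | ∃ i j c, x = e i j c} : Set Cs)

section Unital

variable {A B C D : Type*} [CStarAlgebra A] [CStarAlgebra B] [CStarAlgebra C] [CStarAlgebra D]
  [PartialOrder C] [StarOrderedRing C] [PartialOrder D] [StarOrderedRing D]

/-- A conditional expectation from `C` onto `A`, for a unital inclusion realized by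
`ι : A →⋆ₐ[ℂ] C`. -/
structure CondExpectation [PartialOrder A] [StarOrderedRing A] (ι : A →⋆ₐ[ℂ] C) where
  toFun : C → A
  map_add : ∀ x y, toFun (x + y) = toFun x + toFun y
  map_smul : ∀ (z : ℂ) x, toFun (z • x) = z • toFun x
  map_star : ∀ x, toFun (star x) = star (toFun x)
  retraction : ∀ a, toFun (ι a) = a
  left_mod : ∀ a c, toFun (ι a * c) = a * toFun c
  right_mod : ∀ c a, toFun (c * ι a) = toFun c * a
  pos : ∀ c, 0 ≤ toFun (star c * c)

/-- A quasi-basis for a conditional expectation, in the sense of Watatani. -/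
def IsQuasiBasis [PartialOrder A] [StarOrderedRing A] {ι : A →⋆ₐ[ℂ] C}
    (E : CondExpectation ι) {n : ℕ} (u : Fin n → C) : Prop :=
  ∀ c : C, (∑ i, u i * ι (E.toFun (star (u i) * c)) = c) ∧
    (∑ i, ι (E.toFun (c * u i)) * star (u i) = c)

/-- A conditional expectation is of Watatani index-finite type if it admits a
quasi-basis. -/
def FiniteIndex [PartialOrder A] [StarOrderedRing A] {ι : A →⋆ₐ[ℂ] C}
    (E : CondExpectation ι) : Prop :=
  ∃ (n : ℕ) (u : Fin n → C), IsQuasiBasis E u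

/-- `A' ∩ C = ℂ 1` for the inclusion realized by `ι`. -/
def IrreducibleIncl (ι : A →⋆ₐ[ℂ] C) : Prop :=
  ∀ c : C, (∀ a : A, ι a * c = c * ι a) → ∃ z : ℂ, c = z • (1 : C)

variable [PartialOrder A] [StarOrderedRing A] [PartialOrder B] [StarOrderedRing B]

/-- A conditional expectation `E^X : Y → X` with respect to `E^A` and `E^B`
(Definition 2.4 of [KT4]). -/
structure IsBimodCondExp {Y : Type*}
    [NormedAddCommGroup Y] [NormedSpace ℂ Y] [CompleteSpace Y]
    (ιA : A →⋆ₐ[ℂ] C) (ιB : B →⋆ₐ[ℂ] D)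
    (EA : CondExpectation ιA) (EB : CondExpectation ιB)
    (EY : EquivBimodule C D Y) (X : Submodule ℂ Y) (EX : Y → Y) : Prop where
  map_add : ∀ y y', EX (y + y') = EX y + EX y'
  map_smul : ∀ (z : ℂ) y, EX (z • y) = z • EX y
  mem : ∀ y, EX y ∈ X
  cond1 : ∀ (c : C), ∀ x ∈ X, EX (EY.lsmul c x) = EY.lsmul (ιA (EA.toFun c)) x
  cond2 : ∀ (a : A) (y : Y), EX (EY.lsmul (ιA a) y) = EY.lsmul (ιA a) (EX y)
  cond3 : ∀ (y : Y), ∀ x ∈ X, ιA (EA.toFun (EY.linn y x)) = EY.linn (EX y) x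
  cond4 : ∀ (d : D), ∀ x ∈ X, EX (EY.rsmul x d) = EY.rsmul x (ιB (EB.toFun d))
  cond5 : ∀ (b : B) (y : Y), EX (EY.rsmul y (ιB b)) = EY.rsmul (EX y) (ιB b)
  cond6 : ∀ (y : Y), ∀ x ∈ X, ιB (EB.toFun (EY.rinn y x)) = EY.rinn (EX y) x

/-- The C*-basic construction `C₁` for a conditional expectation `E : C → A`,
realized by a unital embedding `ιC : C →⋆ₐ[ℂ] C₁` and the Jones projection `e`. -/
structure IsBasicConstruction {A C C₁ : Type*} [CStarAlgebra A] [CStarAlgebra C]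
    [CStarAlgebra C₁] [PartialOrder A] [StarOrderedRing A]
    [PartialOrder C] [StarOrderedRing C]
    (ι : A →⋆ₐ[ℂ] C) (E : CondExpectation ι)
    (ιC : C →⋆ₐ[ℂ] C₁) (e : C₁) : Prop where
  inj : Function.Injective ιC
  idem : e * e = e
  selfadj : star e = e
  comm : ∀ a : A, ιC (ι a) * e = e * ιC (ι a)
  expect : ∀ c : C, e * ιC c * e = ιC (ι (E.toFun c)) * e
  faithful : ∀ c : C, ιC c * e = 0 → c = 0
  span : ∀ x : C₁, x ∈ Submodule.span ℂ {z : C₁ | ∃ c d : C, z = ιC c * e * ιC d}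

end Unital

/-- `M` is the `A–B`-equivalence bimodule obtained by restricting the operations of the
`C–D`-equivalence bimodule `EY` to the closed subspace `X` (whose inner products on `X`
take values in the subalgebras realized by `ιA`, `ιB`). -/
structure IsRestriction {A B C D Y : Type*}
    [NonUnitalCStarAlgebra A] [PartialOrder A] [StarOrderedRing A]
    [NonUnitalCStarAlgebra B] [PartialOrder B] [StarOrderedRing B]
    [NonUnitalCStarAlgebra C] [PartialOrder C] [StarOrderedRing C]
    [NonUnitalCStarAlgebra D] [PartialOrder D] [StarOrderedRing D]
    [NormedAddCommGroup Y] [NormedSpace ℂ Y] [CompleteSpace Y]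
    (ιA : A → C) (ιB : B → D)
    (EY : EquivBimodule C D Y) (X : Submodule ℂ Y) [CompleteSpace X]
    (M : EquivBimodule A B X) : Prop where
  lsmul_coe : ∀ (a : A) (x : X), (M.lsmul a x : Y) = EY.lsmul (ιA a) (x : Y)
  rsmul_coe : ∀ (x : X) (b : B), (M.rsmul x b : Y) = EY.rsmul (x : Y) (ιB b)
  linn_coe : ∀ x y : X, ιA (M.linn x y) = EY.linn (x : Y) (y : Y)
  rinn_coe : ∀ x y : X, ιB (M.rinn x y) = EY.rinn (x : Y) (y : Y)

section Upward

variable {A B C D C₁ D₁ : Type*} [CStarAlgebra A] [CStarAlgebra B] [CStarAlgebra C]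
  [CStarAlgebra D] [CStarAlgebra C₁] [CStarAlgebra D₁]
  [PartialOrder A] [StarOrderedRing A] [PartialOrder B] [StarOrderedRing B]
  [PartialOrder C] [StarOrderedRing C] [PartialOrder D] [StarOrderedRing D]
  [PartialOrder C₁] [StarOrderedRing C₁] [PartialOrder D₁] [StarOrderedRing D₁]

/-- A realization of the upward basic construction `C ⊗_A X ⊗_B D̃` as a
`C₁–D₁`-equivalence bimodule, where `M` is the middle `A–B`-equivalence bimodule
(`X` regarded as an `A–B`-bimodule), together with the canonical trilinear map `t`
(the map `(c, x, d) ↦ c ⊗ x ⊗ d̃`, conjugate-linear in the last variable). -/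
structure IsUpwardBasic {Xc T : Type*}
    [NormedAddCommGroup Xc] [NormedSpace ℂ Xc] [CompleteSpace Xc]
    [NormedAddCommGroup T] [NormedSpace ℂ T] [CompleteSpace T]
    (ιA : A →⋆ₐ[ℂ] C) (ιB : B →⋆ₐ[ℂ] D)
    (EA : CondExpectation ιA) (EB : CondExpectation ιB)
    (M : EquivBimodule A B Xc)
    (ιC : C →⋆ₐ[ℂ] C₁) (eA : C₁) (ιD : D →⋆ₐ[ℂ] D₁) (eB : D₁)
    (F : EquivBimodule C₁ D₁ T) (t : C → Xc → D → T) : Prop where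
  add₁ : ∀ c c' x d, t (c + c') x d = t c x d + t c' x d
  smul₁ : ∀ (z : ℂ) c x d, t (z • c) x d = z • t c x d
  add₂ : ∀ c x x' d, t c (x + x') d = t c x d + t c x' d
  smul₂ : ∀ (z : ℂ) c x d, t c (z • x) d = z • t c x d
  add₃ : ∀ c x d d', t c x (d + d') = t c x d + t c x d'
  smul₃ : ∀ (z : ℂ) c x d, t c x (z • d) = (starRingEnd ℂ z) • t c x d
  balanced₁ : ∀ (a : A) c x d, t (c * ιA a) x d = t c (M.lsmul a x) d
  balanced₂ : ∀ (b : B) c x d, t c (M.rsmul x b) d = t c x (d * ιB (star b))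
  map_lsmul : ∀ c' c x d, F.lsmul (ιC c') (t c x d) = t (c' * c) x d
  map_eA : ∀ c x d, F.lsmul eA (t c x d) = t (ιA (EA.toFun c)) x d
  map_rsmul : ∀ c x d d', F.rsmul (t c x d) (ιD d') = t c x (star d' * d)
  map_eB : ∀ c x d, F.rsmul (t c x d) eB = t c x (ιB (EB.toFun d))
  linn_eq : ∀ c c' x x' d d',
    F.linn (t c x d) (t c' x' d') =
      ιC (c * ιA (M.linn (M.rsmul x (EB.toFun (star d * d'))) x')) * eA * ιC (star c')
  rinn_eq : ∀ c c' x x' d d',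
    F.rinn (t c x d) (t c' x' d') =
      ιD d * eB * ιD (ιB (M.rinn x (M.lsmul (EA.toFun (star c * c')) x')) * star d')
  dense : Dense (Submodule.span ℂ {v : T | ∃ c x d, v = t c x d} : Set T)

end Upward



/-- A realization of the `A–K`-equivalence bimodule `X ⊗_B Z` (balanced over `B`),
where `X ⊆ Y` and `Z ⊆ W` come from strong Morita equivalences of the inclusions
`A ⊆ C`, `B ⊆ D` and `B ⊆ D`, `K ⊆ L`. -/
structure IsRelTensor {A B C D K L Y W T : Type*}
    [NonUnitalCStarAlgebra A] [PartialOrder A] [StarOrderedRing A]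
    [NonUnitalCStarAlgebra K] [PartialOrder K] [StarOrderedRing K]
    [NonUnitalCStarAlgebra C] [PartialOrder C] [StarOrderedRing C]
    [NonUnitalCStarAlgebra D] [PartialOrder D] [StarOrderedRing D]
    [NonUnitalCStarAlgebra L] [PartialOrder L] [StarOrderedRing L]
    [NormedAddCommGroup Y] [NormedSpace ℂ Y] [CompleteSpace Y]
    [NormedAddCommGroup W] [NormedSpace ℂ W] [CompleteSpace W]
    [NormedAddCommGroup T] [NormedSpace ℂ T] [CompleteSpace T]
    (ιA : A → C) (ιB : B → D) (ιK : K → L)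
    (EY : EquivBimodule C D Y) (X : Submodule ℂ Y)
    (EW : EquivBimodule D L W) (Z : Submodule ℂ W)
    (F : EquivBimodule A K T) (t : Y → W → T) : Prop where
  add_left : ∀ x ∈ X, ∀ x' ∈ X, ∀ z ∈ Z, t (x + x') z = t x z + t x' z
  smul_left : ∀ (μ : ℂ), ∀ x ∈ X, ∀ z ∈ Z, t (μ • x) z = μ • t x z
  add_right : ∀ x ∈ X, ∀ z ∈ Z, ∀ z' ∈ Z, t x (z + z') = t x z + t x z'
  smul_right : ∀ (μ : ℂ), ∀ x ∈ X, ∀ z ∈ Z, t x (μ • z) = μ • t x z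
  balanced : ∀ (b : B), ∀ x ∈ X, ∀ z ∈ Z,
    t (EY.rsmul x (ιB b)) z = t x (EW.lsmul (ιB b) z)
  map_lsmul : ∀ (a : A), ∀ x ∈ X, ∀ z ∈ Z, F.lsmul a (t x z) = t (EY.lsmul (ιA a) x) z
  map_rsmul : ∀ (k : K), ∀ x ∈ X, ∀ z ∈ Z, F.rsmul (t x z) k = t x (EW.rsmul z (ιK k))
  map_linn : ∀ x ∈ X, ∀ x' ∈ X, ∀ z ∈ Z, ∀ z' ∈ Z,
    ιA (F.linn (t x z) (t x' z')) = EY.linn (EY.rsmul x (EW.linn z z')) x'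
  map_rinn : ∀ x ∈ X, ∀ x' ∈ X, ∀ z ∈ Z, ∀ z' ∈ Z,
    ιK (F.rinn (t x z) (t x' z')) = EW.rinn z (EW.lsmul (EY.rinn x x') z')
  dense : Dense (Submodule.span ℂ {v : T | ∃ x ∈ X, ∃ z ∈ Z, v = t x z} : Set T)

section Helpers

open ComplexConjugate

lemma sesq_bound {V A : Type*} [NormedAddCommGroup V] [NormedSpace ℂ V]
    [NormedAddCommGroup A] [NormedSpace ℂ A] (H : V →ₗ⋆[ℂ] V →ₗ[ℂ] A)
    (hn : ∀ x, ‖H x x‖ = ‖x‖ ^ 2) (x y : V) : ‖H x y‖ ≤ 4 * ‖x‖ * ‖y‖ := by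
  have key : ∀ x y : V, ‖H x y‖ ≤ (‖x‖ + ‖y‖) ^ 2 := by
    intro x y
    have pol : (4 : ℂ) • H x y = H (x + y) (x + y) - H (x - y) (x - y)
        - Complex.I • H (x + Complex.I • y) (x + Complex.I • y)
        + Complex.I • H (x - Complex.I • y) (x - Complex.I • y) := by
      simp only [map_add, map_sub, LinearMap.add_apply, LinearMap.sub_apply,
        LinearMap.map_smulₛₗ, LinearMap.smul_apply, Complex.conj_I, smul_add, smul_sub, smul_smul,
        RingHom.id_apply]
      simp only [mul_neg, Complex.I_mul_I, neg_mul, neg_neg, one_mul, neg_smul, one_smul, mul_one]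
      module
    have h1 : ∀ w : V, ‖w‖ ≤ ‖x‖ + ‖y‖ → ‖H w w‖ ≤ (‖x‖ + ‖y‖) ^ 2 := by
      intro w hw
      rw [hn]
      gcongr
    have e1 := h1 (x + y) (norm_add_le _ _)
    have e2 := h1 (x - y) (norm_sub_le _ _)
    have e3 := h1 (x + Complex.I • y) ((norm_add_le _ _).trans (by simp [norm_smul]))
    have e4 := h1 (x - Complex.I • y) ((norm_sub_le _ _).trans (by simp [norm_smul]))
    have h4 : ‖(4 : ℂ) • H x y‖ = 4 * ‖H x y‖ := by rw [norm_smul]; norm_num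
    have h5 : ‖(4 : ℂ) • H x y‖ ≤ ‖H (x + y) (x + y)‖ + ‖H (x - y) (x - y)‖
        + ‖H (x + Complex.I • y) (x + Complex.I • y)‖
        + ‖H (x - Complex.I • y) (x - Complex.I • y)‖ := by
      rw [pol]
      refine (norm_add_le _ _).trans ?_
      refine add_le_add ((norm_sub_le _ _).trans (add_le_add (norm_sub_le _ _) ?_)) ?_ <;>
        rw [norm_smul, Complex.norm_I, one_mul]
    linarith
  by_cases hx : x = 0
  · simp [hx]
  by_cases hy : y = 0
  · simp [hy]
  have hx' : 0 < ‖x‖ := norm_pos_iff.mpr hx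
  have hy' : 0 < ‖y‖ := norm_pos_iff.mpr hy
  have k := key (((‖x‖⁻¹ : ℝ) : ℂ) • x) (((‖y‖⁻¹ : ℝ) : ℂ) • y)
  have nx : ‖((‖x‖⁻¹ : ℝ) : ℂ) • x‖ = 1 := by
    rw [norm_smul, Complex.norm_real, norm_inv, norm_norm, inv_mul_cancel₀ hx'.ne']
  have ny : ‖((‖y‖⁻¹ : ℝ) : ℂ) • y‖ = 1 := by
    rw [norm_smul, Complex.norm_real, norm_inv, norm_norm, inv_mul_cancel₀ hy'.ne']
  rw [nx, ny, LinearMap.map_smul, H.map_smulₛₗ, LinearMap.smul_apply, smul_comm, norm_smul, norm_smul,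
    Complex.conj_ofReal, Complex.norm_real, Complex.norm_real, norm_inv, norm_inv,
    norm_norm, norm_norm] at k
  calc ‖H x y‖ = ‖x‖ * ‖y‖ * (‖x‖⁻¹ * (‖y‖⁻¹ * ‖H x y‖)) := by field_simp
    _ ≤ ‖x‖ * ‖y‖ * (1 + 1) ^ 2 := by gcongr
    _ = 4 * ‖x‖ * ‖y‖ := by ring

lemma sesq_cont {V A : Type*} [NormedAddCommGroup V] [NormedSpace ℂ V]
    [NormedAddCommGroup A] [NormedSpace ℂ A] (H : V →ₗ⋆[ℂ] V →ₗ[ℂ] A)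
    (hn : ∀ x, ‖H x x‖ = ‖x‖ ^ 2) : Continuous fun p : V × V => H p.1 p.2 := by
  have h := ((H.mkContinuous₂ 4 (sesq_bound H hn)).continuous.comp
    (continuous_fst (X := V) (Y := V))).clm_apply continuous_snd
  simpa using h

lemma sesq_agree {ι V S A : Type*} [NormedAddCommGroup V] [NormedSpace ℂ V]
    [NormedAddCommGroup S] [NormedSpace ℂ S]
    [NormedAddCommGroup A] [NormedSpace ℂ A] (H : V →ₗ⋆[ℂ] V →ₗ[ℂ] A)
    (J : S →ₗ⋆[ℂ] S →ₗ[ℂ] A) (u : ι → V) (v : ι → S)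
    (h : ∀ i j, H (u i) (u j) = J (v i) (v j)) (f g : ι →₀ ℂ) :
    H (Finsupp.linearCombination ℂ u f) (Finsupp.linearCombination ℂ u g)
      = J (Finsupp.linearCombination ℂ v f) (Finsupp.linearCombination ℂ v g) := by
  induction f using Finsupp.induction_linear with
  | zero => simp
  | add f f' hf hf' => simp [hf, hf']
  | single i a =>
    induction g using Finsupp.induction_linear with
    | zero => simp
    | add f f' hf hf' => rw [map_add, map_add, map_add, map_add, hf, hf']
    | single j b =>
      simp only [Finsupp.linearCombination_single, LinearMap.map_smulₛₗ, LinearMap.smul_apply, h]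

namespace EquivBimodule

variable {C D Y W : Type*}
    [NonUnitalCStarAlgebra C] [PartialOrder C] [StarOrderedRing C]
    [NonUnitalCStarAlgebra D] [PartialOrder D] [StarOrderedRing D]
    [NormedAddCommGroup Y] [NormedSpace ℂ Y] [CompleteSpace Y]
    [NormedAddCommGroup W] [NormedSpace ℂ W] [CompleteSpace W]

lemma linn_add_right (E : EquivBimodule C D Y) (x y z : Y) :
    E.linn x (y + z) = E.linn x y + E.linn x z := by
  rw [← E.linn_star, E.linn_add_left, star_add, E.linn_star, E.linn_star]

lemma linn_smul_right (E : EquivBimodule C D Y) (t : ℂ) (x y : Y) :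
    E.linn x (t • y) = conj t • E.linn x y := by
  rw [← E.linn_star, E.linn_smul_left, star_smul, E.linn_star]; rfl

lemma rinn_add_left (E : EquivBimodule C D Y) (x y z : Y) :
    E.rinn (x + y) z = E.rinn x z + E.rinn y z := by
  rw [← E.rinn_star, E.rinn_add_right, star_add, E.rinn_star, E.rinn_star]

lemma rinn_smul_left (E : EquivBimodule C D Y) (t : ℂ) (x y : Y) :
    E.rinn (t • x) y = conj t • E.rinn x y := by
  rw [← E.rinn_star, E.rinn_smul_right, star_smul, E.rinn_star]; rfl

def lform (E : EquivBimodule C D Y) : Y →ₗ⋆[ℂ] Y →ₗ[ℂ] C :=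
  LinearMap.mk₂'ₛₗ (starRingEnd ℂ) (RingHom.id ℂ) (fun x y => E.linn y x)
    (fun x y z => E.linn_add_right z x y) (fun t x y => E.linn_smul_right t y x)
    (fun x y z => E.linn_add_left y z x) (fun t x y => E.linn_smul_left t y x)

def rform (E : EquivBimodule C D Y) : Y →ₗ⋆[ℂ] Y →ₗ[ℂ] D :=
  LinearMap.mk₂'ₛₗ (starRingEnd ℂ) (RingHom.id ℂ) (fun x y => E.rinn x y)
    E.rinn_add_left E.rinn_smul_left E.rinn_add_right (fun t x y => E.rinn_smul_right t x y)

lemma lform_apply (E : EquivBimodule C D Y) (x y : Y) : E.lform x y = E.linn y x := rfl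

lemma rform_apply (E : EquivBimodule C D Y) (x y : Y) : E.rform x y = E.rinn x y := rfl

lemma linn_sub_left (E : EquivBimodule C D Y) (x y z : Y) :
    E.linn (x - y) z = E.linn x z - E.linn y z := by
  simp only [← lform_apply, map_sub]

lemma rinn_sub_right (E : EquivBimodule C D Y) (x y z : Y) :
    E.rinn x (y - z) = E.rinn x y - E.rinn x z := by
  simp only [← rform_apply, map_sub]

lemma eq_of_linn (E : EquivBimodule C D Y) (x y : Y) (h : ∀ z, E.linn x z = E.linn y z) :
    x = y := by
  rw [← sub_eq_zero]
  apply E.linn_definite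
  rw [linn_sub_left, h, sub_self]

lemma eq_of_rinn (E : EquivBimodule C D Y) (x y : Y) (h : ∀ z, E.rinn z x = E.rinn z y) :
    x = y := by
  rw [← sub_eq_zero]
  apply E.rinn_definite
  rw [rinn_sub_right, h, sub_self]

/-- Two equivalence bimodules with total families having equal Gram data are isomorphic. -/
lemma iso_of_gram {ι : Type*} (E : EquivBimodule C D Y) (F : EquivBimodule C D W)
    (u : ι → Y) (v : ι → W)
    (hu : DenseRange (Finsupp.linearCombination ℂ u))
    (hv : DenseRange (Finsupp.linearCombination ℂ v))
    (hl : ∀ i j, E.linn (u i) (u j) = F.linn (v i) (v j))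
    (hr : ∀ i j, E.rinn (u i) (u j) = F.rinn (v i) (v j)) : Nonempty (E.Iso F) := by
  have gl := sesq_agree E.lform F.lform u v (fun i j => hl j i)
  have gr := sesq_agree E.rform F.rform u v hr
  have hn : ∀ f, ‖Finsupp.linearCombination ℂ v f‖ = ‖Finsupp.linearCombination ℂ u f‖ := by
    intro f
    have h := gr f f
    rw [rform_apply, rform_apply] at h
    have h2 : ‖Finsupp.linearCombination ℂ v f‖ ^ 2 = ‖Finsupp.linearCombination ℂ u f‖ ^ 2 := by
      rw [← F.norm_rinn, ← E.norm_rinn, h]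
    exact (pow_left_inj₀ (norm_nonneg _) (norm_nonneg _) two_ne_zero).mp h2
  let Φ : Y ≃ₗᵢ[ℂ] W := (LinearEquiv.refl ℂ (ι →₀ ℂ)).extendOfIsometry
    (Finsupp.linearCombination ℂ u) (Finsupp.linearCombination ℂ v) hu hv hn
  have hΦ : ∀ f, Φ (Finsupp.linearCombination ℂ u f) = Finsupp.linearCombination ℂ v f :=
    fun f => LinearEquiv.extendOfIsometry_eq _ _ _ hu hv hn f
  have cl := sesq_cont E.lform E.norm_linn
  have cl' := sesq_cont F.lform F.norm_linn
  have cr := sesq_cont E.rform E.norm_rinn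
  have cr' := sesq_cont F.rform F.norm_rinn
  have hΦc : Continuous fun p : Y × Y => (Φ p.1, Φ p.2) := by
    have := Φ.continuous
    fun_prop
  have mlin : ∀ x y, F.lform (Φ x) (Φ y) = E.lform x y := by
    intro x y
    refine congrFun ((hu.prodMap hu).equalizer (cl'.comp hΦc) cl ?_) (x, y)
    funext ⟨f, g⟩
    simp only [Function.comp, Prod.map, hΦ, gl]
  have mrin : ∀ x y, F.rform (Φ x) (Φ y) = E.rform x y := by
    intro x y
    refine congrFun ((hu.prodMap hu).equalizer (cr'.comp hΦc) cr ?_) (x, y)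
    funext ⟨f, g⟩
    simp only [Function.comp, Prod.map, hΦ, gr]
  have ml : ∀ x y, F.linn (Φ x) (Φ y) = E.linn x y := fun x y => mlin y x
  have mr : ∀ x y, F.rinn (Φ x) (Φ y) = E.rinn x y := mrin
  exact ⟨{ toEquiv := Φ.toLinearEquiv
           map_linn := ml
           map_rinn := mr
           map_lsmul := by
             intro c y
             refine F.eq_of_linn _ _ fun z => ?_
             obtain ⟨z, rfl⟩ := Φ.surjective z
             rw [F.linn_lsmul_left]
             exact (ml _ _).trans ((E.linn_lsmul_left _ _ _).trans (by rw [← ml]; rfl))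
           map_rsmul := by
             intro y d
             refine F.eq_of_rinn _ _ fun z => ?_
             obtain ⟨z, rfl⟩ := Φ.surjective z
             rw [F.rinn_rsmul_right]
             exact (mr _ _).trans ((E.rinn_rsmul_right _ _ _).trans (by rw [← mr]; rfl)) }⟩

end EquivBimodule

end Helpers

/-- With inclusions `A ⊆ C`, `B ⊆ D`, `K ⊆ L` (with `AC`, `BD`, `KL` dense)
and strong Morita equivalences `(X, Y)` between `A ⊆ C` and `B ⊆ D` and `(Z, W)` between
`B ⊆ D` and `K ⊆ L`, the closure `X ⊗_D Z` of the span of elementary tensors `x ⊗ z`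
inside `Y ⊗_D W`, regarded as an `A–K`-equivalence bimodule, is isomorphic to the
interior tensor product `X ⊗_B Z` as `A–K`-equivalence bimodules. -/
theorem tensor_over_D_iso_tensor_over_B
    {A B C D K L Y W T V : Type*}
    [NonUnitalCStarAlgebra A] [PartialOrder A] [StarOrderedRing A]
    [NonUnitalCStarAlgebra B] [PartialOrder B] [StarOrderedRing B]
    [NonUnitalCStarAlgebra K] [PartialOrder K] [StarOrderedRing K]
    [NonUnitalCStarAlgebra C] [PartialOrder C] [StarOrderedRing C]
    [NonUnitalCStarAlgebra D] [PartialOrder D] [StarOrderedRing D]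
    [NonUnitalCStarAlgebra L] [PartialOrder L] [StarOrderedRing L]
    [NormedAddCommGroup Y] [NormedSpace ℂ Y] [CompleteSpace Y]
    [NormedAddCommGroup W] [NormedSpace ℂ W] [CompleteSpace W]
    [NormedAddCommGroup T] [NormedSpace ℂ T] [CompleteSpace T]
    [NormedAddCommGroup V] [NormedSpace ℂ V] [CompleteSpace V]
    (ιA : A →⋆ₙₐ[ℂ] C) (ιB : B →⋆ₙₐ[ℂ] D) (ιK : K →⋆ₙₐ[ℂ] L)
    (hιA : Function.Injective ιA) (hιB : Function.Injective ιB)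
    (hιK : Function.Injective ιK)
    (hdA : DenseIncl ⇑ιA) (hdB : DenseIncl ⇑ιB) (hdK : DenseIncl ⇑ιK)
    (EY : EquivBimodule C D Y) (X : Submodule ℂ Y)
    (hmorY : IsMoritaIncl ⇑ιA ⇑ιB EY X)
    (EW : EquivBimodule D L W) (Z : Submodule ℂ W)
    (hmorW : IsMoritaIncl ⇑ιB ⇑ιK EW Z)
    -- a realization of the interior tensor product `X ⊗_B Z`
    (F₁ : EquivBimodule A K T) (t₁ : Y → W → T)
    (hF₁ : IsRelTensor ⇑ιA ⇑ιB ⇑ιK EY X EW Z F₁ t₁)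
    -- a realization of `Y ⊗_D W` and its closed subspace `X ⊗_D Z`,
    -- regarded as an `A–K`-equivalence bimodule
    (G : EquivBimodule C L V) (s : Y → W → V) (hG : IsTensorProd EY EW G s)
    (S : Submodule ℂ V)
    (hS : (S : Set V) =
      closure (Submodule.span ℂ {v : V | ∃ x ∈ X, ∃ z ∈ Z, v = s x z} : Set V))
    [CompleteSpace S]
    (F₂ : EquivBimodule A K S) (hF₂ : IsRestriction ⇑ιA ⇑ιK G S F₂) :
    Nonempty (F₁.Iso F₂) := by
  have hmem : ∀ x ∈ X, ∀ z ∈ Z, s x z ∈ S := by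
    intro x hx z hz
    rw [← SetLike.mem_coe, hS]
    exact subset_closure (Submodule.subset_span ⟨x, hx, z, hz, rfl⟩)
  refine EquivBimodule.iso_of_gram (ι := X × Z) F₁ F₂ (fun p => t₁ p.1 p.2)
    (fun p => ⟨s p.1 p.2, hmem _ p.1.2 _ p.2.2⟩) ?_ ?_ ?_ ?_
  · have h := hF₁.dense
    rw [DenseRange, ← LinearMap.coe_range, Finsupp.range_linearCombination]
    convert h using 4
    ext v
    constructor
    · rintro ⟨p, rfl⟩
      exact ⟨p.1, p.1.2, p.2, p.2.2, rfl⟩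
    · rintro ⟨x, hx, z, hz, rfl⟩
      exact ⟨(⟨x, hx⟩, ⟨z, hz⟩), rfl⟩
  · rw [DenseRange, ← LinearMap.coe_range, Finsupp.range_linearCombination]
    refine Subtype.dense_iff.mpr ?_
    have e : (Subtype.val '' ((Submodule.span ℂ (Set.range fun p : X × Z =>
        (⟨s p.1 p.2, hmem _ p.1.2 _ p.2.2⟩ : S)) : Submodule ℂ S) : Set S))
        = (Submodule.span ℂ {v : V | ∃ x ∈ X, ∃ z ∈ Z, v = s x z} : Set V) := by
      rw [← Submodule.coe_subtype, ← Submodule.map_coe, Submodule.map_span, ← Set.range_comp]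
      congr 2
      ext v
      constructor
      · rintro ⟨p, rfl⟩
        exact ⟨p.1, p.1.2, p.2, p.2.2, rfl⟩
      · rintro ⟨x, hx, z, hz, rfl⟩
        exact ⟨(⟨x, hx⟩, ⟨z, hz⟩), rfl⟩
    intro v hv
    have hv' : v ∈ (S : Set V) := hv
    rw [hS, ← e] at hv'
    exact hv'
  · intro i j
    apply hιA
    rw [hF₂.linn_coe, hF₁.map_linn _ i.1.2 _ j.1.2 _ i.2.2 _ j.2.2, hG.map_linn]
  · intro i j
    apply hιK
    rw [hF₂.rinn_coe, hF₁.map_rinn _ i.1.2 _ j.1.2 _ i.2.2 _ j.2.2, hG.map_rinn]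

end
end

section
/- Let A ⊆ C be an inclusion of C*-algebras with AC dense in C. Let Aut(A,C) be the group of automorphisms α of C whose restriction α|_A is an automorphism of A, let Int(A,C) be the subgroup of automorphisms Ad(u) for unitary u ∈ M(A) (noting M(A) ⊆ M(C)), and let π: Aut(A,C) → Pic(A,C) be the homomorphism π(α) = [X_α, Y_α]. Then the sequence 1 → Int(A,C) → Aut(A,C) → Pic(A,C) is exact: π(α) = [A,C] if and only if α ∈ Int(A,C). -/
open scoped MultiplierAlgebra

noncomputable section

section Helpers

variable {C : Type*} [NonUnitalCStarAlgebra C]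

theorem eq_of_forall_mul_right_eq {a b : C} (h : ∀ z, a * z = b * z) : a = b := by
  rw [← sub_eq_zero, ← CStarRing.mul_star_self_eq_zero_iff, sub_mul, h, sub_self]

theorem eq_of_forall_mul_left_eq {a b : C} (h : ∀ z, z * a = z * b) : a = b := by
  rw [← sub_eq_zero, ← CStarRing.star_mul_self_eq_zero_iff, mul_sub, h, sub_self]

theorem mult_snd_mul (u : 𝓜(ℂ, C)) (x y : C) : u.snd (x * y) = x * u.snd y := by
  apply eq_of_forall_mul_right_eq
  intro z
  rw [u.central, mul_assoc, mul_assoc, u.central]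

theorem mult_fst_mul (u : 𝓜(ℂ, C)) (x y : C) : u.fst (x * y) = u.fst x * y := by
  apply eq_of_forall_mul_left_eq
  intro z
  rw [← u.central, ← mul_assoc, ← mul_assoc, u.central]

theorem mult_fst_fst (u v : 𝓜(ℂ, C)) (h : u * v = 1) (x : C) : u.fst (v.fst x) = x := by
  have := congrArg (fun w : 𝓜(ℂ, C) => w.fst x) h
  simpa using this

theorem mult_snd_snd (u v : 𝓜(ℂ, C)) (h : u * v = 1) (x : C) : v.snd (u.snd x) = x := by
  have := congrArg (fun w : 𝓜(ℂ, C) => w.snd x) h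
  simpa using this

theorem mult_star_fst (u : 𝓜(ℂ, C)) (x : C) : (star u).fst x = star (u.snd (star x)) := by
  simp

theorem mult_star_snd (u : 𝓜(ℂ, C)) (x : C) : (star u).snd x = star (u.fst (star x)) := by
  simp

theorem mem_rangeSub_iff {A : Type*} [NonUnitalCStarAlgebra A] (ι : A →⋆ₙₐ[ℂ] C) (x : C) :
    x ∈ rangeSub ⇑ι ↔ x ∈ Set.range ⇑ι := by
  constructor
  · intro h
    refine Submodule.span_induction (fun x h => h) ⟨0, map_zero ι⟩ ?_ ?_ h
    · rintro x y - - ⟨a, rfl⟩ ⟨b, rfl⟩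
      exact ⟨a + b, map_add ι a b⟩
    · rintro z x - ⟨a, rfl⟩
      exact ⟨z • a, map_smul ι z a⟩
  · exact fun h => Submodule.subset_span h

end Helpers

/-- For an inclusion `A ⊆ C` of C*-algebras with `AC` dense in `C`, the
sequence `1 → Int(A,C) → Aut(A,C) → Pic(A,C)` is exact: for `α ∈ Aut(A,C)`,
`π(α) = [X_α, Y_α]` equals `[A, C]` in `Pic(A,C)` if and only if `α = Ad(u)` for a
unitary multiplier `u ∈ M(A) ⊆ M(C)`. -/
theorem exact_Int_Aut_Pic
    {A C : Type*} [NonUnitalCStarAlgebra A]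
    [NonUnitalCStarAlgebra C] [PartialOrder C] [StarOrderedRing C]
    (ι : A →⋆ₙₐ[ℂ] C) (hι : Function.Injective ι) (hd : DenseIncl ⇑ι)
    (α : C ≃⋆ₐ[ℂ] C) (hα : ⇑α '' Set.range ⇑ι = Set.range ⇑ι)
    (Eα : EquivBimodule C C C) (hEα : IsAlphaData ⇑α ⇑α.symm Eα)
    (T : EquivBimodule C C C) (hT : IsTrivialData T) :
    PairEquiv Eα (rangeSub ⇑ι) T (rangeSub ⇑ι) ↔
      ∃ u : 𝓜(ℂ, C), u ∈ unitary 𝓜(ℂ, C) ∧ IsMultiplierOf ⇑ι u ∧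
        ∀ c : C, α c = mAd u c := by
  obtain ⟨e1, e2, e3, e4⟩ := hEα
  obtain ⟨t1, t2, t3, t4⟩ := hT
  constructor
  · rintro ⟨Φ, hΦ⟩
    obtain ⟨f, h1, h2, h3, h4⟩ := Φ
    simp only [e1, e2, e3, e4, t1, t2, t3, t4] at h1 h2 h3 h4 hΦ
    have hn : ∀ x, ‖f x‖ ≤ 1 * ‖x‖ := by
      intro x
      have := congrArg norm (h3 x x)
      rw [CStarRing.norm_self_mul_star, CStarRing.norm_self_mul_star] at this
      rw [one_mul]
      exact (mul_self_le_mul_self_iff (norm_nonneg _) (norm_nonneg _)).2 this.le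
    have hα1 : ∀ x, ‖α x‖ ≤ 1 * ‖x‖ := by
      intro x
      rw [one_mul]
      exact NonUnitalStarAlgHom.norm_apply_le (α : C →⋆ₙₐ[ℂ] C) x
    let αl : C →ₗ[ℂ] C :=
      { toFun := α, map_add' := map_add α, map_smul' := fun z x => map_smul α z x }
    let fc : C →L[ℂ] C := f.toLinearMap.mkContinuous 1 hn
    let u : 𝓜(ℂ, C) :=
      { fst := fc.comp (αl.mkContinuous 1 hα1)
        snd := fc
        central := by
          intro x y
          change f x * y = x * f (α y)
          rw [← h1, ← h2] }
    have us : ∀ x, u.snd x = f x := fun x => rfl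
    have uf : ∀ x, u.fst x = f (α x) := fun x => rfl
    have surj : ∀ z, ∃ y, f (α y) = z := by
      intro z
      exact ⟨α.symm (f.symm z), by simp⟩
    have iso : ∀ x y, star (f (α x)) * f (α y) = star x * y := by
      intro x y
      rw [h4, ← map_star, ← map_mul, StarAlgEquiv.symm_apply_apply]
    have s1 : ∀ x, (star u).snd (u.snd x) = x := by
      intro x
      apply eq_of_forall_mul_right_eq
      intro z
      obtain ⟨y, rfl⟩ := surj z
      rw [mult_star_snd, uf, iso, star_star, us, ← h2, h1]
    have s2 : ∀ x, u.snd ((star u).snd x) = x := by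
      intro x
      obtain ⟨y, rfl⟩ := f.surjective x
      rw [← us, s1]
    have q1 : u * star u = 1 := by
      apply DoubleCentralizer.ext
      apply Prod.ext
      · ext x
        apply eq_of_forall_mul_left_eq
        intro z
        change z * u.fst ((star u).fst x) = z * x
        rw [← u.central, ← (star u).central, s1]
      · ext x
        exact s1 x
    have q2 : star u * u = 1 := by
      apply DoubleCentralizer.ext
      apply Prod.ext
      · ext x
        apply eq_of_forall_mul_left_eq
        intro z
        change z * (star u).fst (u.fst x) = z * x
        rw [← (star u).central, ← u.central, s2]
      · ext x
        exact s2 x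
    have fr : ∀ x, x ∈ Set.range ⇑ι → f x ∈ Set.range ⇑ι := by
      intro x hx
      rw [← mem_rangeSub_iff] at hx ⊢
      rw [← hΦ]
      exact Submodule.mem_map_of_mem hx
    refine ⟨u, Unitary.mem_iff.2 ⟨q2, q1⟩, ⟨fun a => ?_, fun a => ?_⟩, fun c => ?_⟩
    · rw [uf]
      apply fr
      rw [← hα]
      exact ⟨_, ⟨a, rfl⟩, rfl⟩
    · exact fr _ ⟨a, rfl⟩
    · apply eq_of_forall_mul_right_eq
      intro z
      obtain ⟨y, rfl⟩ := surj z
      rw [mAd, ← mult_fst_mul, mult_star_snd, uf (star c), iso, star_star, uf, map_mul, h1]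
  · rintro ⟨u, hu, ⟨m1, m2⟩, had⟩
    obtain ⟨q2, q1⟩ := Unitary.mem_iff.1 hu
    let f : C ≃ₗ[ℂ] C :=
      { toFun := u.snd
        map_add' := map_add u.snd
        map_smul' := fun z x => map_smul u.snd z x
        invFun := (star u).snd
        left_inv := mult_snd_snd u (star u) q1
        right_inv := mult_snd_snd (star u) u q2 }
    have ff : ∀ x, f x = u.snd x := fun x => rfl
    refine ⟨⟨f, ?_, ?_, ?_, ?_⟩, ?_⟩
    · intro c y
      simp only [e1, t1, ff]
      exact mult_snd_mul u c y
    · intro x c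
      simp only [e2, t2, ff]
      apply eq_of_forall_mul_right_eq
      intro z
      rw [u.central, had, mAd, mul_assoc, ← mult_fst_mul, (star u).central,
        mult_fst_fst _ _ q2, ← u.central, mul_assoc]
    · intro x y
      simp only [e3, t3, ff]
      have : star (u.snd y) = (star u).fst (star y) := by rw [mult_star_fst, star_star]
      rw [u.central, this, mult_fst_fst _ _ q1]
    · intro x y
      simp only [e4, t4, ff]
      have : star (u.snd x) = (star u).fst (star x) := by rw [mult_star_fst, star_star]
      apply EquivLike.injective α
      rw [StarAlgEquiv.apply_symm_apply, had, mAd, mult_snd_mul, mult_snd_snd _ _ q1, mult_fst_mul,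
        this, mult_fst_fst _ _ q1]
    · ext x
      rw [Submodule.mem_map, mem_rangeSub_iff]
      constructor
      · rintro ⟨y, hy, rfl⟩
        obtain ⟨a, rfl⟩ := (mem_rangeSub_iff ι y).1 hy
        exact m2 a
      · rintro ⟨a, rfl⟩
        refine ⟨(star u).snd (ι a), (mem_rangeSub_iff ι _).2 ?_, mult_snd_snd _ _ q2 _⟩
        obtain ⟨b, hb⟩ := m1 (star a)
        refine ⟨star b, ?_⟩
        rw [mult_star_snd, map_star, hb, map_star]

end
end
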